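/- Let r be an integer with r ≥ 3. Then ∫₀¹ ∫₀¹ ( t^r (1−u)^r − r t^{r−1}(1−t) u (1−u)^{r−1} − ((t−u)₊)^r )² du dt ≤ 24 · 14 · r² (r−1)² / (2r−4)^{10}, where x₊ = max(x,0). -/

import Mathlib

theorem sub_pow_taylor_bounds (m : ℕ) {a b : ℝ} (hb : 0 ≤ b) (hab : b ≤ a) :
    a ^ (m + 2) - (m + 2) * a ^ (m + 1) * b ≤ (a - b) ^ (m + 2) ∧
      (a - b) ^ (m + 2) ≤ a ^ (m + 2) - (m + 2) * a ^ (m + 1) * b +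
        (m + 2) * (m + 1) / 2 * a ^ m * b ^ 2 := by
  have ha : 0 ≤ a := hb.trans hab
  induction m with
  | zero => constructor <;> norm_num <;> nlinarith [sq_nonneg b]
  | succ m ih =>
    obtain ⟨hl, hu⟩ := ih
    have hc : 0 ≤ a - b := sub_nonneg.2 hab
    have hl' := mul_le_mul_of_nonneg_right hl hc
    have hu' := mul_le_mul_of_nonneg_right hu hc
    have h1 : 0 ≤ ((m : ℝ) + 2) * a ^ (m + 1) * b ^ 2 := by positivity
    have h2 : 0 ≤ ((m : ℝ) + 2) * (m + 1) / 2 * a ^ m * b ^ 3 := by positivity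
    push_cast
    constructor
    · calc _ ≤ (a ^ (m + 2) - (m + 2) * a ^ (m + 1) * b) * (a - b) := by
            rw [← sub_nonneg]; convert h1 using 1; ring
        _ ≤ _ := hl'
        _ = _ := by ring
    · calc _ = (a - b) ^ (m + 2) * (a - b) := by ring
        _ ≤ _ := hu'
        _ ≤ _ := by rw [← sub_nonneg]; convert h2 using 1; ring

theorem abs_taylor_remainder_le (m : ℕ) {a b : ℝ} (ha : 0 ≤ a) (hb : 0 ≤ b) :
    |a ^ (m + 2) - (m + 2) * a ^ (m + 1) * b - (max (a - b) 0) ^ (m + 2)| ≤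
      (m + 2) * (m + 1) / 2 * a ^ m * b ^ 2 := by
  rcases le_total b a with h | h
  · obtain ⟨hl, hu⟩ := sub_pow_taylor_bounds m hb h
    have hp : 0 ≤ ((m : ℝ) + 2) * (m + 1) / 2 * a ^ m * b ^ 2 := by positivity
    rw [max_eq_left (sub_nonneg.2 h), abs_le]
    constructor <;> linarith
  · rw [max_eq_right (sub_nonpos.2 h), zero_pow (by omega), sub_zero]
    have hm : (0 : ℝ) ≤ m := m.cast_nonneg
    have key : |a ^ 2 - (m + 2) * a * b| ≤ ((m : ℝ) + 2) * (m + 1) / 2 * b ^ 2 := by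
      rw [abs_le]
      constructor
      · nlinarith [sq_nonneg (b - a), mul_nonneg hm (sq_nonneg b),
          mul_nonneg (mul_nonneg hm hm) (sq_nonneg b)]
      · have : 0 ≤ ((m : ℝ) + 2) * (m + 1) / 2 * b ^ 2 := by positivity
        nlinarith [mul_nonneg ha (sub_nonneg.2 h), mul_nonneg hm (mul_nonneg ha hb)]
    calc _ = |a ^ m * (a ^ 2 - (m + 2) * a * b)| := by congr 1; ring
      _ = a ^ m * |a ^ 2 - (m + 2) * a * b| := by
          rw [abs_mul, abs_of_nonneg (pow_nonneg ha m)]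
      _ ≤ a ^ m * (((m : ℝ) + 2) * (m + 1) / 2 * b ^ 2) := by gcongr
      _ = _ := by ring

theorem integral_pow_mul_one_sub_pow_four (n : ℕ) :
    ∫ t in (0 : ℝ)..1, t ^ n * (1 - t) ^ 4 =
      24 / (((n : ℝ) + 1) * (n + 2) * (n + 3) * (n + 4) * (n + 5)) := by
  have h : ∀ t : ℝ, t ^ n * (1 - t) ^ 4 =
      t ^ n - 4 * t ^ (n + 1) + 6 * t ^ (n + 2) - 4 * t ^ (n + 3) + t ^ (n + 4) :=
    fun t ↦ by ring
  have hi : ∀ (c : ℝ) (k : ℕ),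
      IntervalIntegrable (fun t : ℝ ↦ c * t ^ k) MeasureTheory.volume 0 1 :=
    fun c k ↦ (by fun_prop : Continuous fun t : ℝ ↦ c * t ^ k).intervalIntegrable _ _
  have hi' : ∀ k : ℕ, IntervalIntegrable (fun t : ℝ ↦ t ^ k) MeasureTheory.volume 0 1 :=
    fun k ↦ (continuous_pow k).intervalIntegrable _ _
  simp_rw [h]
  rw [intervalIntegral.integral_add ((((hi' _).sub (hi _ _)).add (hi _ _)).sub (hi _ _)) (hi' _),
    intervalIntegral.integral_sub (((hi' _).sub (hi _ _)).add (hi _ _)) (hi _ _),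
    intervalIntegral.integral_add ((hi' _).sub (hi _ _)) (hi _ _),
    intervalIntegral.integral_sub (hi' _) (hi _ _)]
  simp only [intervalIntegral.integral_const_mul, integral_pow, one_pow, ne_eq, Nat.add_eq_zero_iff,
    one_ne_zero, and_false, not_false_eq_true, zero_pow, sub_zero]
  push_cast
  have h1 : (n : ℝ) + 1 + 1 = n + 2 := by ring
  have h2 : (n : ℝ) + 2 + 1 = n + 3 := by ring
  have h3 : (n : ℝ) + 3 + 1 = n + 4 := by ring
  have h4 : (n : ℝ) + 4 + 1 = n + 5 := by ring
  rw [h1, h2, h3, h4]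
  field_simp
  ring

theorem integral_one_sub_pow_mul_pow_four (n : ℕ) :
    ∫ u in (0 : ℝ)..1, (1 - u) ^ n * u ^ 4 =
      24 / (((n : ℝ) + 1) * (n + 2) * (n + 3) * (n + 4) * (n + 5)) := by
  have h := intervalIntegral.integral_comp_sub_left (a := (0 : ℝ)) (b := 1)
    (fun t : ℝ ↦ t ^ n * (1 - t) ^ 4) 1
  simp only [sub_sub_cancel, sub_self, sub_zero] at h
  rw [h, integral_pow_mul_one_sub_pow_four]

/-- Lemma 2, integrated bound: for `r ≥ 3`,
`∫₀¹∫₀¹ (t^r (1-u)^r - r t^{r-1}(1-t) u (1-u)^{r-1} - ((t-u)₊)^r)² du dt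
   ≤ 24·14·r²(r-1)²/(2r-4)^{10}`. -/
theorem stmt_16 (r : ℕ) (hr : 3 ≤ r) :
    (∫ t in (0 : ℝ)..1, ∫ u in (0 : ℝ)..1,
        (t ^ r * (1 - u) ^ r - (r : ℝ) * t ^ (r - 1) * (1 - t) * u * (1 - u) ^ (r - 1) -
          (max (t - u) 0) ^ r) ^ 2) ≤
      24 * 14 * (r : ℝ) ^ 2 * ((r : ℝ) - 1) ^ 2 / (2 * (r : ℝ) - 4) ^ 10 := by
  obtain ⟨m, rfl⟩ := Nat.exists_eq_add_of_le' (show 2 ≤ r by omega)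
  have hm : (0 : ℝ) < m := by exact_mod_cast (show 0 < m by omega)
  rw [show m + 2 - 1 = m + 1 by omega]
  push_cast
  set C : ℝ := (((m : ℝ) + 2) * (m + 1) / 2) ^ 2 with hC
  have hbound : ∀ t ∈ Set.Icc (0 : ℝ) 1, ∀ u ∈ Set.Icc (0 : ℝ) 1,
      (t ^ (m + 2) * (1 - u) ^ (m + 2) -
        ((m : ℝ) + 2) * t ^ (m + 1) * (1 - t) * u * (1 - u) ^ (m + 1) -
          (max (t - u) 0) ^ (m + 2)) ^ 2 ≤
        C * (t ^ (2 * m) * (1 - t) ^ 4) * ((1 - u) ^ (2 * m) * u ^ 4) := by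
    intro t ht u hu
    have h := abs_taylor_remainder_le m (mul_nonneg ht.1 (sub_nonneg.2 hu.2))
      (mul_nonneg hu.1 (sub_nonneg.2 ht.2))
    rw [show t * (1 - u) - u * (1 - t) = t - u by ring] at h
    calc _ = |(t * (1 - u)) ^ (m + 2) - (m + 2) * (t * (1 - u)) ^ (m + 1) * (u * (1 - t)) -
          (max (t - u) 0) ^ (m + 2)| ^ 2 := by
            rw [sq_abs, mul_pow, mul_pow]; ring
      _ ≤ ((m + 2) * (m + 1) / 2 * (t * (1 - u)) ^ m * (u * (1 - t)) ^ 2) ^ 2 := by gcongr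
      _ = _ := by rw [hC, mul_pow t]; ring
  set B : ℝ := 24 / (((2 * m : ℕ) + 1 : ℝ) * ((2 * m : ℕ) + 2) * ((2 * m : ℕ) + 3) *
    ((2 * m : ℕ) + 4) * ((2 * m : ℕ) + 5)) with hB
  have hB0 : 0 ≤ B := by positivity
  have hB1 : B ≤ 24 / (2 * (m : ℝ)) ^ 5 := by
    rw [hB]
    push_cast
    calc _ ≤ 24 / (2 * (m : ℝ) * (2 * m) * (2 * m) * (2 * m) * (2 * m)) := by gcongr <;> linarith
      _ = _ := by ring
  have hinner : ∀ t ∈ Set.Icc (0 : ℝ) 1, (∫ u in (0 : ℝ)..1,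
      (t ^ (m + 2) * (1 - u) ^ (m + 2) -
        ((m : ℝ) + 2) * t ^ (m + 1) * (1 - t) * u * (1 - u) ^ (m + 1) -
          (max (t - u) 0) ^ (m + 2)) ^ 2) ≤ C * (t ^ (2 * m) * (1 - t) ^ 4) * B := by
    intro t ht
    rw [hB, ← integral_one_sub_pow_mul_pow_four, ← intervalIntegral.integral_const_mul]
    exact intervalIntegral.integral_mono_on zero_le_one
      (Continuous.intervalIntegrable (by fun_prop) _ _)
      (Continuous.intervalIntegrable (by fun_prop) _ _) (hbound t ht)
  calc _ ≤ ∫ t in (0 : ℝ)..1, C * (t ^ (2 * m) * (1 - t) ^ 4) * B := by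
        refine intervalIntegral.integral_mono_on zero_le_one
          (Continuous.intervalIntegrable ?_ _ _)
          (Continuous.intervalIntegrable (by fun_prop) _ _) hinner
        apply intervalIntegral.continuous_parametric_intervalIntegral_of_continuous'
        fun_prop
    _ = C * B ^ 2 := by
        rw [intervalIntegral.integral_mul_const, intervalIntegral.integral_const_mul,
          integral_pow_mul_one_sub_pow_four, ← hB]
        ring
    _ ≤ C * (24 / (2 * (m : ℝ)) ^ 5) ^ 2 := by gcongr
    _ = 144 * ((m : ℝ) + 2) ^ 2 * (m + 1) ^ 2 / (2 * m) ^ 10 := by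
        rw [hC]
        field_simp
        norm_num
    _ ≤ 24 * 14 * ((m : ℝ) + 2) ^ 2 * (m + 1) ^ 2 / (2 * m) ^ 10 := by gcongr; norm_num
    _ = _ := by ring
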